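/- Let X and Y be real vector spaces. Let 𝔽_X be a family of seminorms on X (each p ∈ 𝔽_X satisfies p(x + y) ≤ p(x) + p(y) and p(a • x) = |a| · p(x)) and let 𝔽_Y be a family of F-seminorms on Y. Let T : X → Y, x̄ ∈ X, and let v ∈ X with v ≠ 0 be such that the set {p(v) : p ∈ 𝔽_X} is bounded above. If the linear map L : X → Y satisfies the Fréchet differentiability conditions for T at x̄ with respect to 𝔽_X and 𝔽_Y, then L(v) is a Gâteaux directional derivative of T at x̄ along v with respect to 𝔽_Y. -/

import Mathlib

/-- An F-seminorm on a real vector space. -/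
def IsFSeminorm {V : Type*} [AddCommGroup V] [Module ℝ V] (p : V → ℝ) : Prop :=
  (∀ x, 0 ≤ p x) ∧ (∀ x y, p (x + y) ≤ p x + p y) ∧
  (∀ (a : ℝ) (x : V), |a| ≤ 1 → p (a • x) ≤ p x) ∧
  (∀ x : V, Filter.Tendsto (fun n : ℕ => p ((1 / (n : ℝ)) • x)) Filter.atTop (nhds 0))

/-- `y` is a Gâteaux directional derivative of `T` at `x0` along `v` with respect to the
family of F-seminorms `q`. -/
def IsGateauxDirDeriv {X Y : Type*} {ι : Type*} [AddCommGroup X] [Module ℝ X]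
    [AddCommGroup Y] [Module ℝ Y]
    (q : ι → Y → ℝ) (T : X → Y) (x0 v : X) (y : Y) : Prop :=
  ∀ (J : Finset ι) (hJ : J.Nonempty) (ε : ℝ), 0 < ε → ∃ δ > (0 : ℝ), ∀ t : ℝ,
    0 < |t| → |t| < δ →
    J.sup' hJ (fun j => q j (t⁻¹ • (T (x0 + t • v) - T x0) - y)) < ε

/-- The map `L` satisfies the Fréchet differentiability conditions (DZ) and (DR) for `T`
at `x0` with respect to the families of F-seminorms `p` on the domain and `q` on the range. -/
def SatisfiesFrechetConditions {X Y : Type*} {ι κ : Type*} [AddCommGroup X] [Module ℝ X]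
    [AddCommGroup Y] [Module ℝ Y]
    (p : ι → X → ℝ) (q : κ → Y → ℝ) (T : X → Y) (x0 : X) (L : X → Y) : Prop :=
  ∀ (J : Finset κ) (hJ : J.Nonempty) (ε : ℝ), 0 < ε →
    ∃ (I : Finset ι) (hI : I.Nonempty) (δ : ℝ), 0 < δ ∧ ∀ u : X,
      (I.sup' hI (fun i => p i u) = 0 →
        J.sup' hJ (fun j => q j (T (x0 + u) - T x0 - L u)) = 0) ∧
      (0 < I.sup' hI (fun i => p i u) → I.sup' hI (fun i => p i u) < δ →
        J.sup' hJ (fun j =>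
          q j ((I.sup' hI (fun i => p i u))⁻¹ • (T (x0 + u) - T x0 - L u))) < ε)

theorem IsFSeminorm.nsmul_le {V : Type*} [AddCommGroup V] [Module ℝ V] {p : V → ℝ}
    (hp : IsFSeminorm p) (n : ℕ) (x : V) : p ((n + 1) • x) ≤ (n + 1 : ℕ) * p x := by
  induction n with
  | zero => simp
  | succ n ih =>
    rw [succ_nsmul]
    refine (hp.2.1 _ _).trans ?_
    push_cast at ih ⊢
    linarith

theorem IsFSeminorm.smul_le {V : Type*} [AddCommGroup V] [Module ℝ V] {p : V → ℝ}
    (hp : IsFSeminorm p) {n : ℕ} (hn : 0 < n) {a : ℝ} (ha : |a| ≤ n) (x : V) :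
    p (a • x) ≤ n * p x := by
  obtain ⟨k, rfl⟩ := Nat.exists_eq_add_one_of_ne_zero hn.ne'
  have hk : (0 : ℝ) < (k + 1 : ℕ) := Nat.cast_pos.2 hn
  have hax : a • x = (a / (k + 1 : ℕ)) • ((k + 1) • x) := by
    rw [← Nat.cast_smul_eq_nsmul ℝ, smul_smul, div_mul_cancel₀ _ hk.ne']
  rw [hax]
  refine (hp.2.2.1 _ _ ?_).trans (hp.nsmul_le k x)
  rwa [abs_div, abs_of_pos hk, div_le_one hk]

theorem stmt8 {X Y : Type*} {ι κ : Type*} [AddCommGroup X] [Module ℝ X]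
    [AddCommGroup Y] [Module ℝ Y]
    (p : ι → X → ℝ)
    (hpadd : ∀ i (x y : X), p i (x + y) ≤ p i x + p i y)
    (hphom : ∀ i (a : ℝ) (x : X), p i (a • x) = |a| * p i x)
    (q : κ → Y → ℝ) (hq : ∀ j, IsFSeminorm (q j))
    (T : X → Y) (x0 : X) (v : X) (hv : v ≠ 0)
    (hbdd : ∃ M : ℝ, ∀ i, p i v ≤ M)
    (L : X →ₗ[ℝ] Y)
    (hL : SatisfiesFrechetConditions p q T x0 (fun u => L u)) :
    IsGateauxDirDeriv q T x0 v (L v) := by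
  intro J hJ ε hε
  obtain ⟨M, hM⟩ := hbdd
  obtain ⟨n, hn⟩ := exists_nat_ge (max M 1)
  have hMn : M ≤ n := (le_max_left _ _).trans hn
  have hn1 : (1 : ℝ) ≤ n := (le_max_right _ _).trans hn
  have hn0 : (0 : ℝ) < n := by linarith
  have hpnonneg : ∀ i x, 0 ≤ p i x := fun i x => by
    have h := hpadd i x ((-1 : ℝ) • x)
    have h0 := hphom i 0 x
    rw [hphom i (-1) x] at h
    simp at h h0
    linarith
  obtain ⟨I, hI, δ, hδ, hu⟩ := hL J hJ (ε / n) (div_pos hε hn0)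
  refine ⟨δ / n, div_pos hδ hn0, fun t ht htδ => ?_⟩
  have ht0 : t ≠ 0 := abs_pos.1 ht
  obtain ⟨hDZ, hDR⟩ := hu (t • v)
  have hsle : I.sup' hI (fun i => p i (t • v)) ≤ |t| * n :=
    Finset.sup'_le _ _ fun i _ => by
      rw [hphom]
      exact mul_le_mul_of_nonneg_left ((hM i).trans hMn) ht.le
  have hs0 : 0 ≤ I.sup' hI (fun i => p i (t • v)) := by
    obtain ⟨i, hi⟩ := hI
    exact (hpnonneg i _).trans (Finset.le_sup' (fun i => p i (t • v)) hi)
  generalize I.sup' hI (fun i => p i (t • v)) = s at hDZ hDR hsle hs0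
  have hquot : t⁻¹ • (T (x0 + t • v) - T x0) - L v
      = t⁻¹ • (T (x0 + t • v) - T x0 - L (t • v)) := by
    rw [smul_sub _ _ (L (t • v)), map_smul, inv_smul_smul₀ ht0]
  rw [hquot, Finset.sup'_lt_iff]
  intro j hj
  generalize T (x0 + t • v) - T x0 - L (t • v) = r at hDZ hDR
  rcases hs0.eq_or_lt with hs | hs
  · have hr : q j r ≤ 0 :=
      (Finset.le_sup' (fun j => q j r) hj).trans_eq (hDZ hs.symm)
    obtain ⟨k, hk⟩ := exists_nat_gt |t⁻¹|
    have hk0 : (0 : ℝ) < k := (abs_nonneg _).trans_lt hk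
    have h := (hq j).smul_le (Nat.cast_pos.1 hk0) hk.le r
    exact (h.trans (mul_nonpos_of_nonneg_of_nonpos hk0.le hr)).trans_lt hε
  · have hr := (Finset.sup'_lt_iff hJ).1
      (hDR hs (hsle.trans_lt ((lt_div_iff₀ hn0).1 htδ))) j hj
    have hts : |t⁻¹ * s| ≤ n := by
      rw [abs_mul, abs_inv, abs_of_pos hs]
      exact (inv_mul_le_iff₀ ht).2 hsle
    have h := (hq j).smul_le (Nat.cast_pos.1 hn0) hts (s⁻¹ • r)
    rw [smul_smul, mul_assoc, mul_inv_cancel₀ hs.ne', mul_one] at h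
    exact h.trans_lt ((lt_div_iff₀' hn0).1 hr)
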